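/- arXiv:2305.04706 — 7 statements merged into one kernel-verified Lean document; each statement's English description precedes it below -/
import Mathlib

section
/- For all u0, u1 ∈ F_11 with u0 ≠ 0 and u1 ≠ 0, the polynomial u = u0 + u1 X satisfies: the number of nonzero coefficients of u·g1 plus the number of nonzero coefficients of u·g2 is at least 12. -/
open Polynomial

theorem card_filter_coeff_ne_zero_le_card_support {R : Type*} [Semiring R] [DecidableEq R]
    (p : R[X]) {n : ℕ} (v : Fin n → R) (hv : ∀ i : Fin n, p.coeff i = v i) :
    (Finset.univ.filter fun i => v i ≠ 0).card ≤ p.support.card := by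
  refine Finset.card_le_card_of_injOn (fun i : Fin n => (i : ℕ)) ?_ Fin.val_injective.injOn
  intro i hi
  simpa [hv] using hi

theorem coeff_linear_mul_quintic {R : Type*} [CommSemiring R] (a b c0 c1 c2 c3 c4 c5 : R)
    (i : Fin 7) :
    ((C a + C b * X) *
      (C c0 + C c1 * X + C c2 * X ^ 2 + C c3 * X ^ 3 + C c4 * X ^ 4 + C c5 * X ^ 5)).coeff i =
      ![a * c0, a * c1 + b * c0, a * c2 + b * c1, a * c3 + b * c2, a * c4 + b * c3,
        a * c5 + b * c4, b * c5] i := by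
  rw [add_mul, mul_assoc, coeff_add, coeff_C_mul, coeff_C_mul]
  fin_cases i <;> simp [coeff_X_mul, coeff_X, coeff_C, coeff_X_pow]

theorem stmt8
    (g1 g2 : Polynomial (ZMod 11))
    (hg1 : g1 = C 8 + C 5 * X + X ^ 2 + X ^ 3 + C 5 * X ^ 4 + C 8 * X ^ 5)
    (hg2 : g2 = C 8 + C 6 * X + X ^ 2 + X ^ 3 + C 6 * X ^ 4 + C 8 * X ^ 5) :
    ∀ u0 u1 : ZMod 11, u0 ≠ 0 → u1 ≠ 0 →
      12 ≤ ((C u0 + C u1 * X) * g1).support.card +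
           ((C u0 + C u1 * X) * g2).support.card := by
  intro u0 u1 h0 h1
  have hg1' : g1 = C 8 + C 5 * X + C 1 * X ^ 2 + C 1 * X ^ 3 + C 5 * X ^ 4 + C 8 * X ^ 5 := by
    simpa only [C_1, one_mul] using hg1
  have hg2' : g2 = C 8 + C 6 * X + C 1 * X ^ 2 + C 1 * X ^ 3 + C 6 * X ^ 4 + C 8 * X ^ 5 := by
    simpa only [C_1, one_mul] using hg2
  rw [hg1', hg2']
  refine le_trans ?_ (add_le_add
    (card_filter_coeff_ne_zero_le_card_support _ _ (coeff_linear_mul_quintic u0 u1 8 5 1 1 5 8))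
    (card_filter_coeff_ne_zero_le_card_support _ _ (coeff_linear_mul_quintic u0 u1 8 6 1 1 6 8)))
  revert u0 u1
  set_option maxRecDepth 100000 in decide
end

section
/- For all u0, u1, u2 ∈ F_11 with u0 ≠ 0 and u2 ≠ 0, the polynomial u = u0 + u1 X + u2 X^2 satisfies: the number of nonzero coefficients of u·g1 plus the number of nonzero coefficients of u·g2 is at least 12. -/
open Polynomial

/-- The coefficients of `(u₀ + u₁X + u₂X²)(a + bX + X² + X³ + bX⁴ + aX⁵)`, lowest degree first. -/
def mulCoeffs {R : Type*} [CommRing R] (a b u0 u1 u2 : R) : Fin 8 → R :=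
  ![u0 * a, u0 * b + u1 * a, u0 + u1 * b + u2 * a, u0 + u1 + u2 * b,
    u0 * b + u1 + u2, u0 * a + u1 * b + u2, u1 * a + u2 * b, u2 * a]

theorem quadratic_mul_eq_sum {R : Type*} [CommRing R] (a b u0 u1 u2 : R) :
    (C u0 + C u1 * X + C u2 * X ^ 2) *
        (C a + C b * X + X ^ 2 + X ^ 3 + C b * X ^ 4 + C a * X ^ 5) =
      ∑ i : Fin 8, C (mulCoeffs a b u0 u1 u2 i) * X ^ (i : ℕ) := by
  simp [Fin.sum_univ_eight, mulCoeffs]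
  ring

theorem card_filter_ne_zero_le_card_support {R : Type*} [Semiring R] [DecidableEq R] {n : ℕ}
    (c : Fin n → R) :
    (Finset.univ.filter fun i => c i ≠ 0).card ≤
      (∑ i, C (c i) * X ^ (i : ℕ)).support.card := by
  refine Finset.card_le_card_of_injOn (fun i => (i : ℕ)) (fun i hi => ?_)
    Fin.val_injective.injOn
  simpa [finsetSum_coeff, coeff_X_pow, Fin.val_inj] using hi

theorem twelve_le_card_mulCoeffs_ne_zero : ∀ u0 u1 u2 : ZMod 11, u0 ≠ 0 → u2 ≠ 0 →
    12 ≤ (Finset.univ.filter fun i => mulCoeffs 8 5 u0 u1 u2 i ≠ 0).card +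
      (Finset.univ.filter fun i => mulCoeffs 8 6 u0 u1 u2 i ≠ 0).card := by
  decide +kernel

theorem stmt9
    (g1 g2 : Polynomial (ZMod 11))
    (hg1 : g1 = C 8 + C 5 * X + X ^ 2 + X ^ 3 + C 5 * X ^ 4 + C 8 * X ^ 5)
    (hg2 : g2 = C 8 + C 6 * X + X ^ 2 + X ^ 3 + C 6 * X ^ 4 + C 8 * X ^ 5) :
    ∀ u0 u1 u2 : ZMod 11, u0 ≠ 0 → u2 ≠ 0 →
      12 ≤ ((C u0 + C u1 * X + C u2 * X ^ 2) * g1).support.card +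
           ((C u0 + C u1 * X + C u2 * X ^ 2) * g2).support.card := by
  intro u0 u1 u2 h0 h2
  rw [hg1, hg2, quadratic_mul_eq_sum, quadratic_mul_eq_sum]
  exact (twelve_le_card_mulCoeffs_ne_zero u0 u1 u2 h0 h2).trans <|
    add_le_add (card_filter_ne_zero_le_card_support _) (card_filter_ne_zero_le_card_support _)
end

section
/- For all u0, u1, u2, u3 ∈ F_11 with u0 ≠ 0 and u3 ≠ 0, the polynomial u = u0 + u1 X + u2 X^2 + u3 X^3 satisfies: the number of nonzero coefficients of u·g1 plus the number of nonzero coefficients of u·g2 is at least 12. -/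
open Polynomial

/-- The `k`-th coefficient of the product of `1 + a X + b X ^ 2 + c X ^ 3` with the palindromic
polynomial `8 + t X + X ^ 2 + X ^ 3 + t X ^ 4 + 8 X ^ 5`. -/
def productCoeff (t a b c : ZMod 11) : Fin 9 → ZMod 11 :=
  ![8, t + 8 * a, 1 + t * a + 8 * b, 1 + a + t * b + 8 * c, t + a + b + t * c,
    8 + t * a + b + c, 8 * a + t * b + c, 8 * b + t * c, 8 * c]

theorem coeff_mul_eq_productCoeff (t a b c : ZMod 11) (k : Fin 9) :
    ((1 + C a * X + C b * X ^ 2 + C c * X ^ 3) *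
      (C 8 + C t * X + X ^ 2 + X ^ 3 + C t * X ^ 4 + C 8 * X ^ 5)).coeff k =
      productCoeff t a b c k := by
  have h : (1 + C a * X + C b * X ^ 2 + C c * X ^ 3) *
      (C 8 + C t * X + X ^ 2 + X ^ 3 + C t * X ^ 4 + C 8 * X ^ 5) =
      ∑ i : Fin 9, C (productCoeff t a b c i) * X ^ (i : ℕ) := by
    simp only [Fin.sum_univ_succ, productCoeff]
    simp
    ring
  rw [h, finsetSum_coeff]
  simp [coeff_C_mul, coeff_X_pow, Fin.val_inj]

theorem card_productCoeff_ne_zero_le (t a b c : ZMod 11) :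
    (Finset.univ.filter fun k => productCoeff t a b c k ≠ 0).card ≤
      ((1 + C a * X + C b * X ^ 2 + C c * X ^ 3) *
        (C 8 + C t * X + X ^ 2 + X ^ 3 + C t * X ^ 4 + C 8 * X ^ 5)).support.card := by
  refine Finset.card_le_card_of_injOn (fun k => (k : ℕ)) (fun k hk => ?_)
    Fin.val_injective.injOn
  simpa [-mem_support_iff, mem_support_iff, coeff_mul_eq_productCoeff] using hk

theorem twelve_le_card_productCoeff_ne_zero : ∀ a b c : ZMod 11, c ≠ 0 →
    12 ≤ (Finset.univ.filter fun k => productCoeff 5 a b c k ≠ 0).card +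
      (Finset.univ.filter fun k => productCoeff 6 a b c k ≠ 0).card := by
  decide +kernel

theorem support_mul_eq_support_normalized_mul {F : Type*} [Field F] {u0 : F} (h : u0 ≠ 0)
    (u1 u2 u3 : F) (g : F[X]) :
    ((C u0 + C u1 * X + C u2 * X ^ 2 + C u3 * X ^ 3) * g).support =
      ((1 + C (u1 / u0) * X + C (u2 / u0) * X ^ 2 + C (u3 / u0) * X ^ 3) * g).support := by
  have hu : C u0 + C u1 * X + C u2 * X ^ 2 + C u3 * X ^ 3 =
      C u0 * (1 + C (u1 / u0) * X + C (u2 / u0) * X ^ 2 + C (u3 / u0) * X ^ 3) := by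
    simp only [mul_add, ← mul_assoc, ← C_mul, mul_div_cancel₀ _ h, mul_one]
  ext k
  rw [hu, mul_assoc, mem_support_iff, mem_support_iff, coeff_C_mul, mul_ne_zero_iff_left h]

theorem stmt10
    (g1 g2 : Polynomial (ZMod 11))
    (hg1 : g1 = C 8 + C 5 * X + X ^ 2 + X ^ 3 + C 5 * X ^ 4 + C 8 * X ^ 5)
    (hg2 : g2 = C 8 + C 6 * X + X ^ 2 + X ^ 3 + C 6 * X ^ 4 + C 8 * X ^ 5) :
    ∀ u0 u1 u2 u3 : ZMod 11, u0 ≠ 0 → u3 ≠ 0 →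
      12 ≤ ((C u0 + C u1 * X + C u2 * X ^ 2 + C u3 * X ^ 3) * g1).support.card +
           ((C u0 + C u1 * X + C u2 * X ^ 2 + C u3 * X ^ 3) * g2).support.card := by
  intro u0 u1 u2 u3 h0 h3
  have : Fact (Nat.Prime 11) := ⟨by norm_num⟩
  rw [support_mul_eq_support_normalized_mul h0, support_mul_eq_support_normalized_mul h0, hg1, hg2]
  exact (twelve_le_card_productCoeff_ne_zero _ _ _ (div_ne_zero h3 h0)).trans
    (add_le_add (card_productCoeff_ne_zero_le ..) (card_productCoeff_ne_zero_le ..))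
end

section
/- For all u0, u1, u2, u3, u4, u5 ∈ F_11 with u0 ≠ 0 and u5 ≠ 0, the polynomial u = u0 + u1 X + u2 X^2 + u3 X^3 + u4 X^4 + u5 X^5 satisfies: the number of nonzero coefficients of u·g1 plus the number of nonzero coefficients of u·g2 is at least 12. -/
open Polynomial

/-- The Hamming weight of a pair of symbols. -/
def pairWeight (x y : ZMod 11) : ℕ :=
  (if x = 0 then 0 else 1) + (if y = 0 then 0 else 1)

/-- The joint weight of the coefficients of `X ^ 1` in `u * g1` and `u * g2`. -/
def weightOne (u0 u1 : ZMod 11) : ℕ :=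
  pairWeight (8 * u1 + 5 * u0) (8 * u1 + 6 * u0)

/-- The joint weight of the coefficients of `X ^ 2` in `u * g1` and `u * g2`. -/
def weightTwo (u0 u1 u2 : ZMod 11) : ℕ :=
  pairWeight (8 * u2 + 5 * u1 + u0) (8 * u2 + 6 * u1 + u0)

/-- The joint weight of the coefficients of `X ^ 3` in `u * g1` and `u * g2`. -/
def weightThree (u0 u1 u2 u3 : ZMod 11) : ℕ :=
  pairWeight (8 * u3 + 5 * u2 + u1 + u0) (8 * u3 + 6 * u2 + u1 + u0)

/-- The joint weight of the coefficients of `X ^ 4` in `u * g1` and `u * g2`. -/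
def weightFour (u0 u1 u2 u3 u4 : ZMod 11) : ℕ :=
  pairWeight (8 * u4 + 5 * u3 + u2 + u1 + 5 * u0) (8 * u4 + 6 * u3 + u2 + u1 + 6 * u0)

/-- The joint weight of the coefficients of `X ^ 5` in `u * g1` and `u * g2`. -/
def weightFive (u0 u1 u2 u3 u4 u5 : ZMod 11) : ℕ :=
  pairWeight (8 * u5 + 5 * u4 + u3 + u2 + 5 * u1 + 8 * u0)
    (8 * u5 + 6 * u4 + u3 + u2 + 6 * u1 + 8 * u0)

/-- If the coefficients of degree `1` to `4` have joint weight at most `3`, then those of degree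
`1` to `9` have joint weight at least `8`. Because `g1` and `g2` are palindromic, the degrees
`6` to `9` are given by the same functions as the degrees `4` to `1`, with `u` reversed. -/
theorem eight_le_of_low_weight_le : ∀ u0 : ZMod 11, u0 ≠ 0 → ∀ u1, ∀ u2,
    weightOne u0 u1 + weightTwo u0 u1 u2 ≤ 3 → ∀ u3,
    weightOne u0 u1 + weightTwo u0 u1 u2 + weightThree u0 u1 u2 u3 ≤ 3 → ∀ u4,
    weightOne u0 u1 + weightTwo u0 u1 u2 + weightThree u0 u1 u2 u3
      + weightFour u0 u1 u2 u3 u4 ≤ 3 → ∀ u5, u5 ≠ 0 →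
    8 ≤ weightOne u0 u1 + weightTwo u0 u1 u2 + weightThree u0 u1 u2 u3
      + weightFour u0 u1 u2 u3 u4 + weightFive u0 u1 u2 u3 u4 u5
      + weightFour u5 u4 u3 u2 u1 + weightThree u5 u4 u3 u2 + weightTwo u5 u4 u3
      + weightOne u5 u4 := by
  decide +kernel

theorem weightFive_reverse (u0 u1 u2 u3 u4 u5 : ZMod 11) :
    weightFive u5 u4 u3 u2 u1 u0 = weightFive u0 u1 u2 u3 u4 u5 := by
  unfold weightFive
  congr 1 <;> ring

theorem eight_le_weight (u0 u1 u2 u3 u4 u5 : ZMod 11) (h0 : u0 ≠ 0) (h5 : u5 ≠ 0) :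
    8 ≤ weightOne u0 u1 + weightTwo u0 u1 u2 + weightThree u0 u1 u2 u3
      + weightFour u0 u1 u2 u3 u4 + weightFive u0 u1 u2 u3 u4 u5
      + weightFour u5 u4 u3 u2 u1 + weightThree u5 u4 u3 u2 + weightTwo u5 u4 u3
      + weightOne u5 u4 := by
  by_contra h
  by_cases hlow : weightOne u0 u1 + weightTwo u0 u1 u2 + weightThree u0 u1 u2 u3
      + weightFour u0 u1 u2 u3 u4 ≤ 3
  · exact h (eight_le_of_low_weight_le u0 h0 u1 u2 (by omega) u3 (by omega) u4 hlow u5 h5)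
  · have := eight_le_of_low_weight_le u5 h5 u4 u3 (by omega) u2 (by omega) u1 (by omega) u0 h0
    rw [weightFive_reverse] at this
    omega

theorem card_support_eq_sum_range {R : Type*} [Semiring R] [DecidableEq R] (p : R[X]) {n : ℕ}
    (hp : p.natDegree < n) :
    p.support.card = ∑ i ∈ Finset.range n, if p.coeff i = 0 then 0 else 1 := by
  have h : p.support = (Finset.range n).filter (fun i => ¬ p.coeff i = 0) := by
    ext i
    simp only [mem_support_iff, Finset.mem_filter, Finset.mem_range, ne_eq, iff_and_self]
    exact fun hi => (le_natDegree_of_ne_zero hi).trans_lt hp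
  rw [h, Finset.card_filter]
  simp only [ite_not]

theorem card_support_mul_palindrome (c u0 u1 u2 u3 u4 u5 : ZMod 11) :
    ((C u0 + C u1 * X + C u2 * X ^ 2 + C u3 * X ^ 3 + C u4 * X ^ 4 + C u5 * X ^ 5) *
      (C 8 + C c * X + X ^ 2 + X ^ 3 + C c * X ^ 4 + C 8 * X ^ 5)).support.card =
    ((if 8 * u0 = 0 then 0 else 1) + (if 8 * u1 + c * u0 = 0 then 0 else 1)
      + (if 8 * u2 + c * u1 + u0 = 0 then 0 else 1)
      + (if 8 * u3 + c * u2 + u1 + u0 = 0 then 0 else 1)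
      + (if 8 * u4 + c * u3 + u2 + u1 + c * u0 = 0 then 0 else 1)
      + (if 8 * u5 + c * u4 + u3 + u2 + c * u1 + 8 * u0 = 0 then 0 else 1)
      + (if 8 * u1 + c * u2 + u3 + u4 + c * u5 = 0 then 0 else 1)
      + (if 8 * u2 + c * u3 + u4 + u5 = 0 then 0 else 1)
      + (if 8 * u3 + c * u4 + u5 = 0 then 0 else 1)
      + (if 8 * u4 + c * u5 = 0 then 0 else 1) + (if 8 * u5 = 0 then 0 else 1)) := by
  have h : (C u0 + C u1 * X + C u2 * X ^ 2 + C u3 * X ^ 3 + C u4 * X ^ 4 + C u5 * X ^ 5) *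
      (C 8 + C c * X + X ^ 2 + X ^ 3 + C c * X ^ 4 + C 8 * X ^ 5) =
      C (8 * u0) + C (8 * u1 + c * u0) * X + C (8 * u2 + c * u1 + u0) * X ^ 2
      + C (8 * u3 + c * u2 + u1 + u0) * X ^ 3
      + C (8 * u4 + c * u3 + u2 + u1 + c * u0) * X ^ 4
      + C (8 * u5 + c * u4 + u3 + u2 + c * u1 + 8 * u0) * X ^ 5
      + C (8 * u1 + c * u2 + u3 + u4 + c * u5) * X ^ 6
      + C (8 * u2 + c * u3 + u4 + u5) * X ^ 7
      + C (8 * u3 + c * u4 + u5) * X ^ 8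
      + C (8 * u4 + c * u5) * X ^ 9 + C (8 * u5) * X ^ 10 := by
    simp only [C_add, C_mul]
    ring
  rw [h, card_support_eq_sum_range (n := 11) _ (Nat.lt_succ_of_le (by compute_degree))]
  simp only [Finset.sum_range_succ, Finset.sum_range_zero, coeff_add, coeff_C_mul, coeff_X_pow,
    coeff_X, coeff_C]
  norm_num

theorem stmt12
    (g1 g2 : Polynomial (ZMod 11))
    (hg1 : g1 = C 8 + C 5 * X + X ^ 2 + X ^ 3 + C 5 * X ^ 4 + C 8 * X ^ 5)
    (hg2 : g2 = C 8 + C 6 * X + X ^ 2 + X ^ 3 + C 6 * X ^ 4 + C 8 * X ^ 5) :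
    ∀ u0 u1 u2 u3 u4 u5 : ZMod 11, u0 ≠ 0 → u5 ≠ 0 →
      12 ≤ ((C u0 + C u1 * X + C u2 * X ^ 2 + C u3 * X ^ 3 + C u4 * X ^ 4 + C u5 * X ^ 5) * g1).support.card +
           ((C u0 + C u1 * X + C u2 * X ^ 2 + C u3 * X ^ 3 + C u4 * X ^ 4 + C u5 * X ^ 5) * g2).support.card := by
  intro u0 u1 u2 u3 u4 u5 h0 h5
  have hu : ∀ x : ZMod 11, x ≠ 0 → 8 * x ≠ 0 := by decide
  have h := eight_le_weight u0 u1 u2 u3 u4 u5 h0 h5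
  simp only [weightOne, weightTwo, weightThree, weightFour, weightFive, pairWeight] at h
  rw [hg1, hg2, card_support_mul_palindrome, card_support_mul_palindrome,
    if_neg (hu u0 h0), if_neg (hu u5 h5)]
  linarith
end

section
/- Let g̃1 = 8 + 5X + X^2 and g̃2 = 8 + 6X + X^2 in F_11[X]. Then 6 is the least element of the set { |supp(u·g̃1)| + |supp(u·g̃2)| : u ∈ F_11[X], u ≠ 0 }; that is, every nonzero codeword of the (2,1,2) convolutional code with generator matrix [g̃1(D) g̃2(D)] has Hamming weight at least 6, and this weight is attained, so the code is MDS. -/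
open Polynomial

lemma fact_prime_eleven : Fact (Nat.Prime 11) := ⟨by norm_num⟩

section

attribute [local instance] fact_prime_eleven

lemma exists_eq_three_monomials {R : Type*} [Semiring R] {f : R[X]} (hf : f.support.card ≤ 3) :
    ∃ (a b c : R) (i j k : ℕ), f = C a * X ^ i + C b * X ^ j + C c * X ^ k := by
  obtain h | h | h | h : f.support.card = 0 ∨ f.support.card = 1 ∨ f.support.card = 2 ∨
      f.support.card = 3 := by omega
  · exact ⟨0, 0, 0, 0, 0, 0, by simpa using h⟩
  · obtain ⟨i, a, -, rfl⟩ := card_support_eq_one.1 h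
    exact ⟨a, 0, 0, i, 0, 0, by simp⟩
  · obtain ⟨i, j, -, a, b, -, -, rfl⟩ := card_support_eq_two.1 h
    exact ⟨a, b, 0, i, j, 0, by simp⟩
  · obtain ⟨i, j, k, -, -, a, b, c, -, -, -, rfl⟩ := card_support_eq_three.1 h
    exact ⟨a, b, c, i, j, k, rfl⟩

/-- Three consecutive vanishing power sums of three terms force the preceding one to vanish. -/
lemma power_sum_eq_zero_of_next_three {K : Type*} [Field K] {a b c A B D : K}
    (hA : A ≠ 0) (hB : B ≠ 0) (hD : D ≠ 0)
    (h1 : a * A + b * B + c * D = 0) (h2 : a * A ^ 2 + b * B ^ 2 + c * D ^ 2 = 0)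
    (h3 : a * A ^ 3 + b * B ^ 3 + c * D ^ 3 = 0) : a + b + c = 0 := by
  have h : A * B * D * (a + b + c) = 0 := by
    linear_combination h3 - (A + B + D) * h2 + (A * B + A * D + B * D) * h1
  simpa [hA, hB, hD] using h

/-- If `w = v * p / g ^ m` where `v` is an eigenvector of the Euler operator `X d/dX` and the pole
of `p / g ^ m` at `z` has order `m`, then applying the Euler operator minus a scalar raises the
order of the pole by one, as long as `m ≠ 0` in the field. -/
lemma exists_euler_pole_succ {K : Type*} [Field K] {g v w p : K[X]} {m : ℕ} {z s : K} (e : K)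
    (hz : z ≠ 0) (hg : g.eval z = 0) (hg' : (derivative g).eval z ≠ 0) (hp : p.eval z ≠ 0)
    (hm : (m : K) ≠ 0) (hv : X * derivative v = C s * v) (h : g ^ m * w = v * p) :
    ∃ q : K[X], q.eval z ≠ 0 ∧ g ^ (m + 1) * (X * derivative w - C e * w) = v * q := by
  refine ⟨g * (X * derivative p + C s * p - C e * p) - C (m : K) * X * derivative g * p, ?_, ?_⟩
  · simp [hg, hz, hg', hp, hm]
  · have hd := congrArg derivative h
    have hm0 : m ≠ 0 := by rintro rfl; simp at hm
    obtain ⟨l, rfl⟩ := Nat.exists_eq_succ_of_ne_zero hm0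
    simp only [derivative_mul, derivative_pow, Nat.succ_eq_add_one, Nat.add_sub_cancel] at hd h ⊢
    linear_combination X * g * hd - C e * g * h + g * p * hv
      - C ((l + 1 : ℕ) : K) * X * derivative g * h

lemma euler_sub_monomial {K : Type*} [Field K] (a e : K) (i : ℕ) :
    X * derivative (C a * X ^ i) - C e * (C a * X ^ i) = C (((i : K) - e) * a) * X ^ i := by
  cases i with
  | zero => simp
  | succ n => simp; ring

lemma euler_sub_three_monomials {K : Type*} [Field K] (a b c e : K) (i j k : ℕ) :
    X * derivative (C a * X ^ i + C b * X ^ j + C c * X ^ k)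
        - C e * (C a * X ^ i + C b * X ^ j + C c * X ^ k) =
      C (((i : K) - e) * a) * X ^ i + C (((j : K) - e) * b) * X ^ j
        + C (((k : K) - e) * c) * X ^ k := by
  rw [← euler_sub_monomial, ← euler_sub_monomial, ← euler_sub_monomial]
  simp only [derivative_add]
  ring

lemma ten_dvd_of_two_pow_eq_one {n : ℕ} (h : (2 : ZMod 11) ^ n = 1) : 10 ∣ n := by
  have h10 : (2 : ZMod 11) ^ 10 = 1 := by decide
  rw [← Nat.div_add_mod n 10, pow_add, pow_mul, h10, one_pow, one_mul] at h
  have key : ∀ r < 10, (2 : ZMod 11) ^ r = 1 → r = 0 := by decide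
  exact Nat.dvd_of_mod_eq_zero (key _ (Nat.mod_lt _ (by norm_num)) h)

lemma two_le_card_support_of_root {K : Type*} [Field K] {f : K[X]} {z : K} (hf : f ≠ 0)
    (hz : z ≠ 0) (h : f.eval z = 0) : 2 ≤ f.support.card := by
  by_contra! hlt
  have h0 : f.support.card ≠ 0 := by simpa using hf
  obtain ⟨i, a, ha, rfl⟩ := card_support_eq_one.1 (show f.support.card = 1 by omega)
  simp [ha, hz] at h

/-- A binomial over `F₁₁` vanishing at `2z` and `4z` has the form `a X ^ k (1 - X ^ n)`
with `10 ∣ n`. -/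
lemma exists_eq_of_card_support_eq_two {v : (ZMod 11)[X]} {z : ZMod 11} (hz : z ≠ 0)
    (h2 : v.eval (2 * z) = 0) (h4 : v.eval (4 * z) = 0) (hv : v.support.card = 2) :
    ∃ (a : ZMod 11) (k n : ℕ), a ≠ 0 ∧ (∀ x : ZMod 11, x ≠ 0 → x ^ n = 1) ∧
      v = C a * X ^ k - C a * X ^ (k + n) := by
  obtain ⟨k, m, hkm, a, b, ha, hb, rfl⟩ := card_support_eq_two.1 hv
  obtain ⟨n, rfl⟩ := Nat.exists_eq_add_of_lt hkm
  rw [add_assoc] at *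
  generalize n + 1 = n at *
  have htwo : (2 : ZMod 11) ≠ 0 := by decide
  have h2z : (2 * z) ≠ 0 := mul_ne_zero htwo hz
  simp only [eval_add, eval_mul, eval_C, eval_pow, eval_X] at h2 h4
  have h4z : 4 * z = 2 * (2 * z) := by ring
  rw [h4z] at h4
  generalize 2 * z = y at *
  have hn : (2 : ZMod 11) ^ n = 1 := by
    have : b * y ^ (k + n) * 2 ^ k * (2 ^ n - 1) = 0 := by
      rw [mul_pow, mul_pow] at h4
      linear_combination h4 - 2 ^ k * h2
    have := (mul_eq_zero.1 this).resolve_left (by positivity)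
    exact sub_eq_zero.1 this
  have hx : ∀ x : ZMod 11, x ≠ 0 → x ^ n = 1 := by
    intro x hx
    obtain ⟨t, rfl⟩ := ten_dvd_of_two_pow_eq_one hn
    rw [pow_mul, ZMod.pow_card_sub_one_eq_one hx, one_pow]
  refine ⟨a, k, n, ha, hx, ?_⟩
  have hab : y ^ k * (b + a) = 0 := by
    rw [pow_add, hx y h2z] at h2
    linear_combination h2
  have : b = -a := eq_neg_of_add_eq_zero_left
    ((mul_eq_zero.1 hab).resolve_left (pow_ne_zero _ h2z))
  subst this
  simp [sub_eq_add_neg]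

lemma four_le_card_support_of_card_support_eq_two {g h u : (ZMod 11)[X]} {z : ZMod 11}
    (hz : z ≠ 0) (g2 : g.eval (2 * z) = 0) (g4 : g.eval (4 * z) = 0)
    (g4' : (derivative g).eval (4 * z) ≠ 0) (h4 : h.eval (4 * z) ≠ 0)
    (g8 : g.eval (8 * z) ≠ 0) (g16 : g.eval (16 * z) ≠ 0) (g32 : g.eval (32 * z) ≠ 0)
    (hu : (u * g).support.card = 2) : 4 ≤ (u * h).support.card := by
  by_contra! hlt
  obtain ⟨A, B, D, i, j, l, hw⟩ := exists_eq_three_monomials (Nat.le_of_lt_succ hlt)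
  obtain ⟨a, k, n, ha, hn, hv⟩ := exists_eq_of_card_support_eq_two hz
    (by simp [g2]) (by simp [g4]) hu
  have hv0 : u * g ≠ 0 := by
    intro h0
    simp [h0] at hu
  have hz4 : 4 * z ≠ 0 := mul_ne_zero (by decide) hz
  have euler : X * derivative (u * g) = C (k : ZMod 11) * (u * g)
      - C ((n : ZMod 11) * a) * X ^ (k + n) := by
    have e1 := euler_sub_monomial a k k
    have e2 := euler_sub_monomial a k (k + n)
    rw [hv, derivative_sub]
    simp only [sub_self, zero_mul, C_0, Nat.cast_add, add_sub_cancel_left] at e1 e2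
    linear_combination e1 - e2
  by_cases hn0 : (n : ZMod 11) = 0
  · simp only [hn0, zero_mul, C_0, sub_zero] at euler
    obtain ⟨p, hp, h1⟩ := exists_euler_pole_succ (m := 1) (w := u * h) (i : ZMod 11) hz4 g4 g4' h4
      (by decide) euler (by ring)
    obtain ⟨q, hq, h2⟩ := exists_euler_pole_succ (j : ZMod 11) hz4 g4 g4' hp (by decide) euler h1
    obtain ⟨r, hr, h3⟩ := exists_euler_pole_succ (l : ZMod 11) hz4 g4 g4' hq (by decide) euler h2
    rw [hw, euler_sub_three_monomials, euler_sub_three_monomials, euler_sub_three_monomials] at h3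
    simp only [sub_self, zero_mul, mul_zero, C_0, add_zero] at h3
    rcases mul_eq_zero.1 h3.symm with h0 | h0
    · exact hv0 h0
    · simp [h0] at hr
  · have hu4 : u.eval (4 * z) ≠ 0 := by
      intro h0
      have := congrArg (eval (4 * z)) euler
      simp only [derivative_mul, eval_mul, eval_add, eval_sub, eval_C, eval_X, eval_pow, g4, h0]
        at this
      simp [ha, hn0, hz4] at this
    have vanish : ∀ x : ZMod 11, x ≠ 0 → g.eval x ≠ 0 → (u * h).eval x = 0 := by
      intro x hx hgx
      have := congrArg (eval x) hv
      simp only [eval_mul, eval_sub, eval_C, eval_X, eval_pow, pow_add, hn x hx, mul_one,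
        sub_self] at this
      simp [(mul_eq_zero.1 this).resolve_right hgx]
    have w8 := vanish (8 * z) (mul_ne_zero (by decide) hz) g8
    have w16 := vanish (16 * z) (mul_ne_zero (by decide) hz) g16
    have w32 := vanish (32 * z) (mul_ne_zero (by decide) hz) g32
    have w4 : (u * h).eval (4 * z) ≠ 0 := by simp [hu4, h4]
    rw [show 8 * z = 2 * (4 * z) by ring] at w8
    rw [show 16 * z = 2 ^ 2 * (4 * z) by ring] at w16
    rw [show 32 * z = 2 ^ 3 * (4 * z) by ring] at w32
    rw [hw] at w4 w8 w16 w32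
    simp only [eval_add, eval_mul, eval_C, eval_X, eval_pow, mul_pow] at w4 w8 w16 w32
    simp only [pow_right_comm (2 : ZMod 11) 2, pow_right_comm (2 : ZMod 11) 3] at w16 w32
    have htwo : ∀ e : ℕ, (2 : ZMod 11) ^ e ≠ 0 := fun e => pow_ne_zero e (by decide)
    refine w4 (power_sum_eq_zero_of_next_three (htwo i) (htwo j) (htwo l) ?_ ?_ ?_)
    · linear_combination w8
    · linear_combination w16
    · linear_combination w32

lemma card_support_eight_add_mul_X_add_sq {b : ZMod 11} (hb : b ≠ 0) :
    (C 8 + C b * X + X ^ 2 : (ZMod 11)[X]).support.card = 3 := by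
  have := card_support_trinomial (k := 0) (m := 1) (n := 2) (by norm_num) (by norm_num)
    (show (8 : ZMod 11) ≠ 0 by decide) hb one_ne_zero
  simpa only [pow_zero, mul_one, pow_one, C_1, one_mul] using this

lemma six_le_weight {u g1 g2 : (ZMod 11)[X]} (hu : u ≠ 0)
    (hg1 : g1 = C 8 + C 5 * X + X ^ 2) (hg2 : g2 = C 8 + C 6 * X + X ^ 2) :
    6 ≤ (u * g1).support.card + (u * g2).support.card := by
  have ev1 : ∀ x, g1.eval x = 8 + 5 * x + x ^ 2 := by intro x; simp [hg1]
  have ev2 : ∀ x, g2.eval x = 8 + 6 * x + x ^ 2 := by intro x; simp [hg2]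
  have dv1 : ∀ x, (derivative g1).eval x = 5 + 2 * x := by
    intro x; simp [hg1, one_add_one_eq_two]
  have dv2 : ∀ x, (derivative g2).eval x = 6 + 2 * x := by
    intro x; simp [hg2, one_add_one_eq_two]
  have hne1 : g1 ≠ 0 := by
    rintro h
    have := ev1 0
    rw [h, eval_zero] at this
    revert this; decide
  have hne2 : g2 ≠ 0 := by
    rintro h
    have := ev2 0
    rw [h, eval_zero] at this
    revert this; decide
  have c1 : 2 ≤ (u * g1).support.card := two_le_card_support_of_root (z := 2)
    (mul_ne_zero hu hne1) (by decide)
    (by rw [eval_mul, ev1, show (8 + 5 * 2 + 2 ^ 2 : ZMod 11) = 0 by decide, mul_zero])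
  have c2 : 2 ≤ (u * g2).support.card := two_le_card_support_of_root (z := -2)
    (mul_ne_zero hu hne2) (by decide)
    (by rw [eval_mul, ev2, show (8 + 6 * -2 + (-2) ^ 2 : ZMod 11) = 0 by decide, mul_zero])
  have d1 : (u * g1).support.card = 2 → 4 ≤ (u * g2).support.card := by
    apply four_le_card_support_of_card_support_eq_two (z := 1) <;>
      simp only [ne_eq, ev1, ev2, dv1] <;> decide
  have d2 : (u * g2).support.card = 2 → 4 ≤ (u * g1).support.card := by
    apply four_le_card_support_of_card_support_eq_two (z := -1) <;>
      simp only [ne_eq, ev1, ev2, dv2] <;> decide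
  omega

end

theorem stmt15
    (g1 g2 : Polynomial (ZMod 11))
    (hg1 : g1 = C 8 + C 5 * X + X ^ 2)
    (hg2 : g2 = C 8 + C 6 * X + X ^ 2) :
    IsLeast {w : ℕ | ∃ u : Polynomial (ZMod 11), u ≠ 0 ∧
      w = (u * g1).support.card + (u * g2).support.card} 6 := by
  constructor
  · refine ⟨1, fun h => ?_, ?_⟩
    · have : (1 : ZMod 11) = 0 := by simpa using congrArg (eval 0) h
      revert this; decide
    · rw [one_mul, one_mul, hg1, hg2, card_support_eight_add_mul_X_add_sq (by decide),
        card_support_eight_add_mul_X_add_sq (by decide)]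
  · rintro _ ⟨u, hu, rfl⟩
    exact six_le_weight hu hg1 hg2
end

section
/- Let F_9 be the field with nine elements and let α ∈ F_9 be any primitive element (a generator of the multiplicative group, i.e., of multiplicative order 8). Set p1(X) = (X−α)(X−α^2) and p2(X) = p1(α^{−4}X) in F_9[X], write p1 = c0 + c1 X + c2 X^2 and p2 = d0 + d1 X + d2 X^2, and define the palindromic extensions P1 = c0 + c1 X + c2 X^2 + c2 X^3 + c1 X^4 + c0 X^5 and P2 = d0 + d1 X + d2 X^2 + d2 X^3 + d1 X^4 + d0 X^5. Then there exists a nonzero polynomial u ∈ F_9[X] such that the number of nonzero coefficients of u·P1 plus the number of nonzero coefficients of u·P2 is strictly less than 12; that is, the resulting (2,1,5) convolutional code over F_9 is not MDS. -/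
open Polynomial

/-- The palindromic extension `a + b X + c X² + c X³ + b X⁴ + a X⁵`, multiplied by `1 - X`. -/
lemma one_sub_X_mul_palindrome {R : Type*} [CommRing R] (a b c : R) :
    (1 - X) * (C a + C b * X + C c * X ^ 2 + C c * X ^ 3 + C b * X ^ 4 + C a * X ^ 5) =
      C a * X ^ 0 + C (b - a) * X ^ 1 + C (c - b) * X ^ 2 + C (b - c) * X ^ 4 +
        C (a - b) * X ^ 5 + C (-a) * X ^ 6 := by
  simp only [C_sub, C_neg]
  ring

lemma support_one_sub_X_mul_palindrome_subset {R : Type*} [CommRing R] (a b c : R)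
    {s : Finset ℕ} (h0 : 0 ∈ s) (h6 : 6 ∈ s) (hab : a = b ∨ (1 ∈ s ∧ 5 ∈ s))
    (hbc : b = c ∨ (2 ∈ s ∧ 4 ∈ s)) :
    ((1 - X) * (C a + C b * X + C c * X ^ 2 + C c * X ^ 3 + C b * X ^ 4 +
      C a * X ^ 5)).support ⊆ s := by
  intro n hn
  rw [one_sub_X_mul_palindrome, mem_support_iff] at hn
  contrapose! hn
  have n0 : n ≠ 0 := fun h => hn (h ▸ h0)
  have n6 : n ≠ 6 := fun h => hn (h ▸ h6)
  have n15 : a = b ∨ (n ≠ 1 ∧ n ≠ 5) :=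
    hab.imp_right fun h => ⟨fun e => hn (e ▸ h.1), fun e => hn (e ▸ h.2)⟩
  have n24 : b = c ∨ (n ≠ 2 ∧ n ≠ 4) :=
    hbc.imp_right fun h => ⟨fun e => hn (e ▸ h.1), fun e => hn (e ▸ h.2)⟩
  simp only [coeff_add, coeff_C_mul_X_pow]
  rcases n15 with rfl | ⟨n1, n5⟩ <;> rcases n24 with rfl | ⟨n2, n4⟩ <;> simp [*]

lemma card_support_one_sub_X_mul_palindrome_le_six {R : Type*} [CommRing R] (a b c : R) :
    ((1 - X) * (C a + C b * X + C c * X ^ 2 + C c * X ^ 3 + C b * X ^ 4 +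
      C a * X ^ 5)).support.card ≤ 6 :=
  Finset.card_le_card (t := {0, 1, 2, 4, 5, 6}) <|
    support_one_sub_X_mul_palindrome_subset a b c (by simp) (by simp) (by simp) (by simp)

lemma card_support_one_sub_X_mul_palindrome_le_four {R : Type*} [CommRing R] {a b c : R}
    (h : a = b ∨ b = c) :
    ((1 - X) * (C a + C b * X + C c * X ^ 2 + C c * X ^ 3 + C b * X ^ 4 +
      C a * X ^ 5)).support.card ≤ 4 := by
  rcases h with h | h
  · exact Finset.card_le_card (t := {0, 2, 4, 6}) <|
      support_one_sub_X_mul_palindrome_subset a b c (by simp) (by simp) (.inl h) (by simp)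
  · exact Finset.card_le_card (t := {0, 1, 5, 6}) <|
      support_one_sub_X_mul_palindrome_subset a b c (by simp) (by simp) (by simp) (.inl h)

lemma pow_four_eq_neg_one_of_orderOf_eq_eight {R : Type*} [CommRing R] [IsDomain R] {a : R}
    (ha : orderOf a = 8) : a ^ 4 = -1 := by
  have h8 : a ^ 8 = 1 := ha ▸ pow_orderOf_eq_one a
  have h4 : a ^ 4 ≠ 1 := pow_ne_one_of_lt_orderOf (by norm_num) (by omega)
  exact (mul_self_eq_one_iff.mp (by rw [← pow_add]; exact h8)).resolve_left h4

/-- In characteristic three, `X⁴ + 1` factors as `(X² - X - 1) (X² + X - 1)`. -/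
lemma sq_eq_or_of_pow_four_eq_neg_one {R : Type*} [CommRing R] [IsDomain R] [CharP R 3] {a : R}
    (ha : a ^ 4 = -1) : a ^ 2 - a - 1 = 0 ∨ a ^ 2 + a - 1 = 0 := by
  have h3 : (3 : R) = 0 := by exact_mod_cast CharP.cast_eq_zero R 3
  refine mul_eq_zero.mp ?_
  linear_combination ha - a ^ 2 * h3

theorem stmt16
    (α : GaloisField 3 2) (hα : orderOf α = 8)
    (p1 p2 P1 P2 : Polynomial (GaloisField 3 2))
    (hp1 : p1 = (X - C α) * (X - C (α ^ 2)))
    (hp2 : p2 = p1.comp (C (α⁻¹ ^ 4) * X))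
    (hP1 : P1 = C (p1.coeff 0) + C (p1.coeff 1) * X + C (p1.coeff 2) * X ^ 2 +
                C (p1.coeff 2) * X ^ 3 + C (p1.coeff 1) * X ^ 4 + C (p1.coeff 0) * X ^ 5)
    (hP2 : P2 = C (p2.coeff 0) + C (p2.coeff 1) * X + C (p2.coeff 2) * X ^ 2 +
                C (p2.coeff 2) * X ^ 3 + C (p2.coeff 1) * X ^ 4 + C (p2.coeff 0) * X ^ 5) :
    ∃ u : Polynomial (GaloisField 3 2), u ≠ 0 ∧
      (u * P1).support.card + (u * P2).support.card < 12 := by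
  have h4 := pow_four_eq_neg_one_of_orderOf_eq_eight hα
  have hinv : α⁻¹ ^ 4 = -1 := by rw [inv_pow, h4, inv_neg, inv_one]
  have hp2' : p2 = C 1 * X ^ 2 + C (α + α ^ 2) * X + C (α ^ 3) := by
    rw [hp2, hp1, hinv]
    simp only [mul_comp, sub_comp, X_comp, pow_comp, C_comp, C_neg, C_add, C_pow, C_1]
    ring
  have e0 : p2.coeff 0 = α ^ 3 := by
    rw [hp2']; simp [-map_pow]
  have e1 : p2.coeff 1 = α + α ^ 2 := by
    rw [hp2']; simp [-map_add, -map_pow, coeff_C, coeff_X_pow]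
  have e2 : p2.coeff 2 = 1 := by
    rw [hp2']; simp [-map_add, -map_pow]
  have hcoeff : p2.coeff 0 = p2.coeff 1 ∨ p2.coeff 1 = p2.coeff 2 := by
    rw [e0, e1, e2]
    refine (sq_eq_or_of_pow_four_eq_neg_one h4).imp (fun h => ?_) (fun h => ?_)
    · linear_combination α * h
    · linear_combination h
  have hu : (1 - X : (GaloisField 3 2)[X]) ≠ 0 := fun h => by
    simpa using congrArg (coeff · 0) h
  refine ⟨1 - X, hu, ?_⟩
  have b1 := card_support_one_sub_X_mul_palindrome_le_six (p1.coeff 0) (p1.coeff 1) (p1.coeff 2)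
  have b2 := card_support_one_sub_X_mul_palindrome_le_four hcoeff
  rw [hP1, hP2]
  omega
end

section
/- Let α ∈ F_11 be a primitive element (of multiplicative order 10) with α ≠ 2. Set p1(X) = (X−α)(X−α^2) and p2(X) = p1(α^{−5}X) in F_11[X], write p1 = c0 + c1 X + c2 X^2 and p2 = d0 + d1 X + d2 X^2, and define the palindromic extensions P1 = c0 + c1 X + c2 X^2 + c2 X^3 + c1 X^4 + c0 X^5 and P2 = d0 + d1 X + d2 X^2 + d2 X^3 + d1 X^4 + d0 X^5. Then there exists a nonzero polynomial u ∈ F_11[X] such that the number of nonzero coefficients of u·P1 plus the number of nonzero coefficients of u·P2 is strictly less than 12; that is, the resulting (2,1,5) convolutional code over F_11 is not MDS. -/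
open Polynomial

/-- The palindromic extension of a polynomial of degree at most two to degree five. -/
noncomputable def palindromicExtension (p : (ZMod 11)[X]) : (ZMod 11)[X] :=
  C (p.coeff 0) + C (p.coeff 1) * X + C (p.coeff 2) * X ^ 2 +
    C (p.coeff 2) * X ^ 3 + C (p.coeff 1) * X ^ 4 + C (p.coeff 0) * X ^ 5

theorem palindromicExtension_quadratic (a b c : ZMod 11) :
    palindromicExtension (C a + C b * X + C c * X ^ 2) =
      C a + C b * X + C c * X ^ 2 + C c * X ^ 3 + C b * X ^ 4 + C a * X ^ 5 := by
  simp [palindromicExtension, coeff_X, coeff_C]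

theorem card_support_sum_C_mul_X_pow_le {R : Type*} [Semiring R] (s : Finset ℕ) (f : ℕ → R) :
    (∑ i ∈ s, C (f i) * X ^ i).support.card ≤ s.card := by
  refine Finset.card_le_card fun n hn => ?_
  by_contra h
  simp [coeff_X_pow, h] at hn

theorem eq_of_orderOf_eq_ten {α : ZMod 11} (hα : orderOf α = 10) :
    α = 2 ∨ α = 6 ∨ α = 7 ∨ α = 8 := by
  have h2 : α ^ 2 ≠ 1 := fun h => by
    have := orderOf_dvd_of_pow_eq_one h
    norm_num [hα] at this
  have h5 : α ^ 5 ≠ 1 := fun h => by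
    have := orderOf_dvd_of_pow_eq_one h
    norm_num [hα] at this
  have h10 : α ^ 10 = 1 := hα ▸ pow_orderOf_eq_one α
  clear hα
  revert α
  decide

/-- A multiplier `u` together with the coefficients of its two products bounds the weight of the
codeword it generates. -/
theorem exists_weight_lt (P Q u : (ZMod 11)[X]) (hu : u ≠ 0) (s t : Finset ℕ)
    (f g : ℕ → ZMod 11) (hP : u * P = ∑ i ∈ s, C (f i) * X ^ i)
    (hQ : u * Q = ∑ i ∈ t, C (g i) * X ^ i) (hst : s.card + t.card < 12) :
    ∃ u : (ZMod 11)[X], u ≠ 0 ∧ (u * P).support.card + (u * Q).support.card < 12 := by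
  refine ⟨u, hu, ?_⟩
  rw [hP, hQ]
  exact (add_le_add (card_support_sum_C_mul_X_pow_le s f)
    (card_support_sum_C_mul_X_pow_le t g)).trans_lt hst

theorem ne_zero_of_coeff_zero_eq_one {u : (ZMod 11)[X]} (h : u.coeff 0 = 1) : u ≠ 0 := by
  rintro rfl
  exact absurd h (by decide)

theorem stmt17
    (α : ZMod 11) (hα : orderOf α = 10) (hα2 : α ≠ 2)
    (p1 p2 P1 P2 : Polynomial (ZMod 11))
    (hp1 : p1 = (X - C α) * (X - C (α ^ 2)))
    (hp2 : p2 = p1.comp (C (α⁻¹ ^ 5) * X))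
    (hP1 : P1 = C (p1.coeff 0) + C (p1.coeff 1) * X + C (p1.coeff 2) * X ^ 2 +
                C (p1.coeff 2) * X ^ 3 + C (p1.coeff 1) * X ^ 4 + C (p1.coeff 0) * X ^ 5)
    (hP2 : P2 = C (p2.coeff 0) + C (p2.coeff 1) * X + C (p2.coeff 2) * X ^ 2 +
                C (p2.coeff 2) * X ^ 3 + C (p2.coeff 1) * X ^ 4 + C (p2.coeff 0) * X ^ 5) :
    ∃ u : Polynomial (ZMod 11), u ≠ 0 ∧
      (u * P1).support.card + (u * P2).support.card < 12 := by
  have hα' := (eq_of_orderOf_eq_ten hα).resolve_left hα2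
  have h5 : α⁻¹ ^ 5 = -1 := by
    have h : α ^ 5 = -1 := by rcases hα' with rfl | rfl | rfl <;> decide
    have : Fact (Nat.Prime 11) := ⟨by norm_num⟩
    rw [inv_pow, h, inv_neg, inv_one]
  have hq1 : p1 = C (α ^ 3) + C (-(α + α ^ 2)) * X + C 1 * X ^ 2 := by
    rw [hp1]
    simp only [map_neg, map_add, map_pow, map_one]
    ring
  have hq2 : p2 = C (α ^ 3) + C (α + α ^ 2) * X + C 1 * X ^ 2 := by
    rw [hp2, hq1, h5]
    simp only [add_comp, mul_comp, pow_comp, neg_comp, one_comp, C_comp, X_comp, map_neg, map_one]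
    ring
  change P1 = palindromicExtension p1 at hP1
  change P2 = palindromicExtension p2 at hP2
  rw [hq1, palindromicExtension_quadratic] at hP1
  rw [hq2, palindromicExtension_quadratic] at hP2
  subst hP1 hP2
  clear hα hα2 hp1 hp2 hq1 hq2 h5
  rcases hα' with rfl | rfl | rfl
  · refine exists_weight_lt _ _ (1 + 5 * X + 6 * X ^ 2 + 10 * X ^ 3)
      (ne_zero_of_coeff_zero_eq_one (by simp)) {0, 1, 2, 6, 7, 8} {0, 3, 5, 8}
      (fun i => [7, 4, 9, 0, 0, 0, 2, 7, 4].getD i 0)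
      (fun i => [7, 0, 0, 9, 0, 2, 0, 0, 4].getD i 0) ?_ ?_ (by decide) <;>
    · simp [C_ofNat]
      grind
  · refine exists_weight_lt _ _ (1 - X)
      (ne_zero_of_coeff_zero_eq_one (by simp)) {0, 1, 2, 4, 5, 6} {0, 1, 5, 6}
      (fun i => [2, 8, 2, 0, 9, 3, 9].getD i 0)
      (fun i => [2, 10, 0, 0, 0, 1, 9].getD i 0) ?_ ?_ (by decide) <;>
    · simp [C_ofNat]
      grind
  · refine exists_weight_lt _ _ (1 - X)
      (ne_zero_of_coeff_zero_eq_one (by simp)) {0, 1, 2, 4, 5, 6} {0, 2, 4, 6}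
      (fun i => [6, 10, 7, 0, 4, 1, 5].getD i 0)
      (fun i => [6, 0, 6, 0, 5, 0, 5].getD i 0) ?_ ?_ (by decide) <;>
    · simp [C_ofNat]
      grind
end
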